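/- Let P be a polynomial with complex coefficients of degree n having no zeros in the open unit disk {z : |z| < 1}, and let α, β be complex numbers with |α| ≤ 1 and |β| ≤ 1. Then for every real R ≥ 1 and every complex z with |z| ≥ 1, |P(Rz) − α·P(z) + β(((R+1)/2)^n − |α|)·P(z)| ≤ (1/2)·[ |R^n − α + β(((R+1)/2)^n − |α|)| · |z|^n + |1 − α + β(((R+1)/2)^n − |α|)| ] · max_{|w|=1} |P(w)|. -/

import Mathlib

open Polynomial

/-- The modified Smirnov operator: S̃ₐ[P](z) = (1+az)·P′(z) − n·a·P(z). -/
noncomputable def smirnov (n : ℕ) (a : ℂ) (P : Polynomial ℂ) (z : ℂ) : ℂ :=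
  (1 + a * z) * P.derivative.eval z - (n : ℂ) * a * P.eval z

/-- The maximum of ‖P‖ on the unit circle. -/
noncomputable def maxCircle (P : Polynomial ℂ) : ℝ :=
  sSup {y : ℝ | ∃ w : ℂ, ‖w‖ = 1 ∧ y = ‖P.eval w‖}

theorem norm_eval_eq_prod_roots (p : ℂ[X]) (z : ℂ) :
    ‖p.eval z‖ = ‖p.leadingCoeff‖ * (p.roots.map fun w => ‖z - w‖).prod := by
  conv_lhs => rw [(IsAlgClosed.splits p).eq_prod_roots]
  rw [eval_mul, eval_C, eval_multiset_prod, norm_mul, Multiset.map_map]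
  congr 1
  exact (map_multiset_prod (normHom : ℂ →*₀ ℝ) _).trans
    (by simp [Multiset.map_map])

theorem pow_natDegree_mul_norm_eval_le {p : ℂ[X]} {c : ℝ} (hc : 0 ≤ c) {x y : ℂ}
    (h : ∀ w ∈ p.roots, c * ‖x - w‖ ≤ ‖y - w‖) :
    c ^ p.natDegree * ‖p.eval x‖ ≤ ‖p.eval y‖ := by
  have hmap : c ^ p.natDegree * (p.roots.map fun w => ‖x - w‖).prod
      = (p.roots.map fun w => c * ‖x - w‖).prod := by
    rw [Multiset.prod_map_mul, (IsAlgClosed.splits p).natDegree_eq_card_roots]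
    simp
  rw [norm_eval_eq_prod_roots, norm_eval_eq_prod_roots, mul_left_comm, hmap]
  exact mul_le_mul_of_nonneg_left
    (Multiset.prod_map_le_prod_map₀ _ _ (fun _ _ => by positivity) h) (norm_nonneg _)

theorem norm_sub_le_norm_mul_sub {R : ℝ} (hR : 1 ≤ R) {z w : ℂ} (hz : 1 ≤ ‖z‖) (hw : ‖w‖ ≤ 1) :
    (R + 1) / 2 * ‖z - w‖ ≤ ‖(R : ℂ) * z - w‖ := by
  have h1 : (R : ℂ) * z - w = ((R + 1) / 2 : ℝ) * (z - w) + ((R - 1) / 2 : ℝ) * (z + w) := by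
    push_cast; ring
  have hsq : ((R + 1) / 2 * ‖z - w‖) ^ 2 ≤ ‖(R : ℂ) * z - w‖ ^ 2 := by
    have hzw : w.re ^ 2 + w.im ^ 2 ≤ z.re ^ 2 + z.im ^ 2 := by
      have := pow_le_pow_left₀ (norm_nonneg w) (hw.trans hz) 2
      rw [Complex.sq_norm, Complex.sq_norm, Complex.normSq_apply, Complex.normSq_apply] at this
      linarith
    have hR0 : 0 ≤ (R + 1) * (R - 1) := mul_nonneg (by linarith) (by linarith)
    rw [h1, mul_pow, Complex.sq_norm, Complex.sq_norm, Complex.normSq_apply,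
      Complex.normSq_apply]
    simp only [Complex.add_re, Complex.sub_re, Complex.mul_re, Complex.ofReal_re,
      Complex.ofReal_im, Complex.add_im, Complex.sub_im, Complex.mul_im]
    nlinarith [mul_nonneg hR0 (sub_nonneg.2 hzw),
      sq_nonneg ((R - 1) * (z.re + w.re)), sq_nonneg ((R - 1) * (z.im + w.im))]
  exact le_of_sq_le_sq hsq (norm_nonneg _)

theorem pow_mul_norm_eval_le_norm_eval_mul {p : ℂ[X]}
    (hp : ∀ w : ℂ, 1 < ‖w‖ → p.eval w ≠ 0) {R : ℝ} (hR : 1 ≤ R) {z : ℂ} (hz : 1 ≤ ‖z‖) :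
    ((R + 1) / 2) ^ p.natDegree * ‖p.eval z‖ ≤ ‖p.eval ((R : ℂ) * z)‖ := by
  refine pow_natDegree_mul_norm_eval_le (by linarith) fun w hw =>
    norm_sub_le_norm_mul_sub hR hz ?_
  by_contra! hw1
  exact hp w hw1 (isRoot_of_mem_roots hw)

theorem eval_reflect {n : ℕ} {p : ℂ[X]} (hp : p.natDegree ≤ n) {z : ℂ} (hz : z ≠ 0) :
    (p.reflect n).eval z = z ^ n * p.eval z⁻¹ := by
  let := invertibleOfNonzero (inv_ne_zero hz)
  have h := eval₂_reflect_mul_pow (RingHom.id ℂ) z⁻¹ n p hp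
  rw [invOf_eq_inv, inv_inv, eval₂_id, eval₂_id] at h
  rw [← h, mul_left_comm, ← mul_pow, mul_inv_cancel₀ hz, one_pow, mul_one]

/-- The conjugate reciprocal `z ^ n * conj (p (1 / conj z))` of `p`, with respect to the formal
degree `n`. -/
noncomputable def conjReflect (n : ℕ) (p : ℂ[X]) : ℂ[X] :=
  (p.reflect n).map (starRingEnd ℂ)

theorem eval_conjReflect {n : ℕ} {p : ℂ[X]} (hp : p.natDegree ≤ n) {z : ℂ} (hz : z ≠ 0) :
    (conjReflect n p).eval z
      = z ^ n * starRingEnd ℂ (p.eval (starRingEnd ℂ z)⁻¹) := by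
  have hz' : starRingEnd ℂ z ≠ 0 := by simpa using hz
  have h := Polynomial.eval_map_apply (p := p.reflect n) (f := starRingEnd ℂ) (starRingEnd ℂ z)
  rw [Complex.conj_conj] at h
  rw [conjReflect, h, eval_reflect hp hz', map_mul, map_pow, Complex.conj_conj]

theorem natDegree_conjReflect_le {n : ℕ} {p : ℂ[X]} (hp : p.natDegree ≤ n) :
    (conjReflect n p).natDegree ≤ n :=
  natDegree_map_le.trans ((natDegree_reflect_le).trans (by simp [hp]))

theorem coeff_conjReflect_self (n : ℕ) (p : ℂ[X]) :
    (conjReflect n p).coeff n = starRingEnd ℂ (p.eval 0) := by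
  simp [conjReflect, coeff_reflect, revAt_le, coeff_zero_eq_eval_zero]

theorem norm_eval_le_norm_eval_conjReflect {n : ℕ} {p : ℂ[X]} (hp : p.natDegree ≤ n)
    (hp0 : ∀ w : ℂ, ‖w‖ < 1 → p.eval w ≠ 0) {z : ℂ} (hz : 1 < ‖z‖) :
    ‖p.eval z‖ ≤ ‖(conjReflect n p).eval z‖ := by
  have hz0 : z ≠ 0 := norm_pos_iff.1 (by linarith)
  have hz' : starRingEnd ℂ z ≠ 0 := by simpa using hz0
  have h : ‖z‖⁻¹ ^ p.natDegree * ‖p.eval z‖ ≤ ‖p.eval (starRingEnd ℂ z)⁻¹‖ := by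
    refine pow_natDegree_mul_norm_eval_le (by positivity) fun w hw => ?_
    have hw1 : 1 ≤ ‖w‖ := by
      by_contra! hw1
      exact hp0 w hw1 (isRoot_of_mem_roots hw)
    have hfac : (starRingEnd ℂ z)⁻¹ - w = (starRingEnd ℂ z)⁻¹ * (1 - starRingEnd ℂ z * w) := by
      field_simp
    rw [hfac, norm_mul, norm_inv, RCLike.norm_conj]
    gcongr
    refine le_of_sq_le_sq ?_ (norm_nonneg _)
    have hz2 := one_le_pow₀ hz.le (n := 2)
    have hw2 := one_le_pow₀ hw1 (n := 2)
    rw [Complex.sq_norm, Complex.normSq_apply] at hz2 hw2 ⊢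
    rw [Complex.sq_norm, Complex.normSq_apply]
    simp only [Complex.sub_re, Complex.sub_im, Complex.mul_re, Complex.mul_im, Complex.conj_re,
      Complex.conj_im, Complex.one_re, Complex.one_im]
    nlinarith [mul_nonneg (sub_nonneg.2 hz2) (sub_nonneg.2 hw2)]
  rw [eval_conjReflect hp hz0, norm_mul, norm_pow, RCLike.norm_conj]
  rw [inv_pow, inv_mul_le_iff₀ (by positivity)] at h
  exact h.trans (mul_le_mul_of_nonneg_right (pow_le_pow_right₀ hz.le hp) (norm_nonneg _))

theorem norm_coeff_le_of_norm_eval_le {n : ℕ} {p q : ℂ[X]} (hp : p.natDegree ≤ n)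
    (hq : q.natDegree ≤ n) (h : ∀ w : ℂ, 1 < ‖w‖ → ‖p.eval w‖ ≤ ‖q.eval w‖) :
    ‖p.coeff n‖ ≤ ‖q.coeff n‖ := by
  have hcoeff : ∀ r : ℂ[X], r.coeff n = (r.reflect n).eval 0 := fun r => by
    simp [← coeff_zero_eq_eval_zero, coeff_reflect, revAt_le]
  have ht : ∀ r : ℂ[X], Filter.Tendsto (fun w => ‖(r.reflect n).eval w‖) (nhdsWithin 0 {0}ᶜ)
      (nhds ‖(r.reflect n).eval 0‖) := fun r =>
    (r.reflect n).continuous.norm.continuousAt.tendsto.mono_left nhdsWithin_le_nhds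
  rw [hcoeff, hcoeff]
  refine le_of_tendsto_of_tendsto (ht p) (ht q) ?_
  filter_upwards [self_mem_nhdsWithin, nhdsWithin_le_nhds (Metric.ball_mem_nhds 0 one_pos)]
    with w hw0 hw1
  rw [eval_reflect hp hw0, eval_reflect hq hw0, norm_mul, norm_mul]
  gcongr
  refine h _ ?_
  rw [norm_inv]
  exact (one_lt_inv₀ (norm_pos_iff.2 hw0)).2 (mem_ball_zero_iff.1 hw1)

/-- A Bernstein-type comparison: domination outside the unit disk is preserved by
`p ↦ p (R z) - γ p z`. -/
theorem norm_eval_mul_sub_le_of_dominated {n : ℕ} {p q : ℂ[X]} (hp : p.natDegree ≤ n)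
    (hq : q.natDegree ≤ n) (hqn : q.coeff n ≠ 0) (hq0 : ∀ w : ℂ, 1 < ‖w‖ → q.eval w ≠ 0)
    (h : ∀ w : ℂ, 1 < ‖w‖ → ‖p.eval w‖ ≤ ‖q.eval w‖) {R : ℝ} (hR : 1 ≤ R) {γ : ℂ}
    (hγ : ‖γ‖ < ((R + 1) / 2) ^ n) {z : ℂ} (hz : 1 < ‖z‖) :
    ‖p.eval ((R : ℂ) * z) - γ * p.eval z‖ ≤ ‖q.eval ((R : ℂ) * z) - γ * q.eval z‖ := by
  have key : ∀ g : ℂ[X], g.natDegree ≤ n → g.coeff n ≠ 0 →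
      (∀ w : ℂ, 1 < ‖w‖ → g.eval w ≠ 0) → g.eval ((R : ℂ) * z) - γ * g.eval z ≠ 0 := by
    intro g hg hgn hg0 he
    have hdeg : g.natDegree = n := le_antisymm hg (le_natDegree_of_ne_zero hgn)
    have h1 := pow_mul_norm_eval_le_norm_eval_mul hg0 hR hz.le
    rw [hdeg, sub_eq_zero.1 he, norm_mul] at h1
    exact absurd hγ (not_lt.2 (le_of_mul_le_mul_right h1 (norm_pos_iff.2 (hg0 z hz))))
  have hTq := key q hq hqn hq0
  by_contra! hlt
  set A := p.eval ((R : ℂ) * z) - γ * p.eval z with hA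
  set B := q.eval ((R : ℂ) * z) - γ * q.eval z with hB
  have hμ : 1 < ‖A / B‖ := by
    rwa [norm_div, one_lt_div (norm_pos_iff.2 hTq)]
  have aux : ∀ a b : ℂ, ‖a‖ ≤ ‖b‖ → b ≠ 0 → a - A / B * b ≠ 0 := by
    intro a b hab hb he
    rw [sub_eq_zero.1 he, norm_mul] at hab
    have := norm_pos_iff.2 hb
    nlinarith
  refine key (p - C (A / B) * q) ?_ ?_ ?_ ?_
  · exact (natDegree_sub_le _ _).trans (max_le hp ((natDegree_C_mul_le _ _).trans hq))
  · rw [coeff_sub, coeff_C_mul]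
    exact aux _ _ (norm_coeff_le_of_norm_eval_le hp hq h) hqn
  · intro w hw
    rw [eval_sub, eval_C_mul]
    exact aux _ _ (h w hw) (hq0 w hw)
  · have : A - A / B * B = 0 := by field_simp; ring
    simp only [eval_sub, eval_mul, eval_C]
    linear_combination this + hA - A / B * hB

theorem exists_norm_eq_one_norm_sub_mul (a b : ℂ) :
    ∃ u : ℂ, ‖u‖ = 1 ∧ ‖a - u * b‖ = |‖a‖ - ‖b‖| := by
  refine ⟨Complex.exp ((a.arg - b.arg : ℝ) * Complex.I), Complex.norm_exp_ofReal_mul_I _, ?_⟩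
  have ha := Complex.norm_mul_exp_arg_mul_I a
  have hb := Complex.norm_mul_exp_arg_mul_I b
  have h : a - Complex.exp ((a.arg - b.arg : ℝ) * Complex.I) * b
      = ((‖a‖ - ‖b‖ : ℝ) : ℂ) * Complex.exp (a.arg * Complex.I) := by
    push_cast
    rw [sub_mul, Complex.exp_sub, sub_mul]
    have he := Complex.exp_ne_zero (b.arg * Complex.I)
    rw [div_mul_eq_mul_div, sub_eq_iff_eq_add, ← sub_eq_iff_eq_add', eq_div_iff he]
    linear_combination Complex.exp (a.arg * Complex.I) * hb - Complex.exp (b.arg * Complex.I) * ha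
  rw [h, norm_mul, Complex.norm_exp_ofReal_mul_I, mul_one, Complex.norm_real, Real.norm_eq_abs]

theorem norm_eval_le_maxCircle (P : ℂ[X]) {w : ℂ} (hw : ‖w‖ ≤ 1) :
    ‖P.eval w‖ ≤ maxCircle P := by
  have hset : {y : ℝ | ∃ w : ℂ, ‖w‖ = 1 ∧ y = ‖P.eval w‖}
      = (fun w => ‖P.eval w‖) '' Metric.sphere 0 1 := by
    ext y; simp [eq_comm]
  have hbdd : BddAbove {y : ℝ | ∃ w : ℂ, ‖w‖ = 1 ∧ y = ‖P.eval w‖} :=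
    hset ▸ ((isCompact_sphere (0 : ℂ) 1).image P.continuous.norm).bddAbove
  refine Complex.norm_le_of_forall_mem_frontier_norm_le (U := Metric.ball 0 1)
    Metric.isBounded_ball P.differentiable.diffContOnCl (fun v hv => ?_) ?_
  · rw [frontier_ball _ one_ne_zero, mem_sphere_zero_iff_norm] at hv
    exact le_csSup hbdd ⟨v, hv, rfl⟩
  · rwa [closure_ball _ one_ne_zero, mem_closedBall_zero_iff]

/-- The estimate for `‖γ‖` strictly below the critical size, outside the closed unit disk. -/
theorem norm_eval_mul_sub_le_of_lt {n : ℕ} {P : ℂ[X]} (hP : P.natDegree ≤ n)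
    (hP0 : ∀ w : ℂ, ‖w‖ < 1 → P.eval w ≠ 0) {m : ℝ} (hm : ∀ w : ℂ, ‖w‖ ≤ 1 → ‖P.eval w‖ < m)
    {R : ℝ} (hR : 1 ≤ R) {γ : ℂ} (hγ : ‖γ‖ < ((R + 1) / 2) ^ n) {z : ℂ} (hz : 1 < ‖z‖) :
    ‖P.eval ((R : ℂ) * z) - γ * P.eval z‖
      ≤ (1 / 2) * (‖(R : ℂ) ^ n - γ‖ * ‖z‖ ^ n + ‖1 - γ‖) * m := by
  have hm0 : 0 < m := (norm_nonneg _).trans_lt (hm 0 (by simp))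
  have hne : ∀ {w : ℂ}, 1 < ‖w‖ → w ≠ 0 := fun hw => norm_pos_iff.1 (by linarith)
  have hinv : ∀ {w : ℂ}, 1 < ‖w‖ → ‖(starRingEnd ℂ w)⁻¹‖ < 1 := fun {w} hw => by
    rw [norm_inv, RCLike.norm_conj]; exact inv_lt_one_of_one_lt₀ hw
  have hRz : (R : ℂ) * z ≠ 0 :=
    mul_ne_zero (by exact_mod_cast (by linarith : R ≠ 0)) (hne hz)
  have compare : ∀ p : ℂ[X], p.natDegree ≤ n → (∀ w : ℂ, ‖w‖ < 1 → p.eval w ≠ 0) →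
      ‖p.eval ((R : ℂ) * z) - γ * p.eval z‖
        ≤ ‖(conjReflect n p).eval ((R : ℂ) * z) - γ * (conjReflect n p).eval z‖ := by
    intro p hp hp0
    refine norm_eval_mul_sub_le_of_dominated hp (natDegree_conjReflect_le hp) ?_ ?_
      (fun w hw => norm_eval_le_norm_eval_conjReflect hp hp0 hw) hR hγ hz
    · rw [coeff_conjReflect_self]
      simpa using hp0 0 (by simp)
    · intro w hw
      rw [eval_conjReflect hp (hne hw)]
      exact mul_ne_zero (pow_ne_zero _ (hne hw)) (by simpa using hp0 _ (hinv hw))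
  set A := (conjReflect n P).eval ((R : ℂ) * z) - γ * (conjReflect n P).eval z with hA
  have hPA : ‖P.eval ((R : ℂ) * z) - γ * P.eval z‖ ≤ ‖A‖ := compare P hP hP0
  set B : ℂ := m * (((R : ℂ) * z) ^ n - γ * z ^ n) with hB
  have hBn : ‖B‖ = m * (‖(R : ℂ) ^ n - γ‖ * ‖z‖ ^ n) := by
    rw [hB, mul_pow, ← sub_mul, norm_mul, norm_mul, norm_pow, Complex.norm_real,
      Real.norm_of_nonneg hm0.le]
  have hmC : (m : ℂ) ≠ 0 := by exact_mod_cast hm0.ne'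
  have hAB : ‖A‖ ≤ ‖B‖ := by
    have := norm_eval_mul_sub_le_of_dominated (q := C (m : ℂ) * X ^ n)
      (natDegree_conjReflect_le hP) (natDegree_C_mul_X_pow_le _ _) (by simpa using hmC)
      (fun w hw => by simpa [hmC] using fun h => absurd h (hne hw)) (fun w hw => ?_) hR hγ hz
    · convert this using 2
      simp only [eval_mul, eval_C, eval_pow, eval_X, hB]
      ring
    · rw [eval_conjReflect hP (hne hw), norm_mul, RCLike.norm_conj, eval_mul, eval_C, eval_pow,
        eval_X, norm_mul, Complex.norm_real, Real.norm_of_nonneg hm0.le, norm_pow, mul_comm]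
      gcongr
      exact (hm _ (hinv hw).le).le
  obtain ⟨u, hu, huAB⟩ := exists_norm_eq_one_norm_sub_mul A B
  set c : ℂ := starRingEnd ℂ u * m with hc
  have hcn : ‖c‖ = m := by
    rw [hc, norm_mul, RCLike.norm_conj, hu, one_mul, Complex.norm_real,
      Real.norm_of_nonneg hm0.le]
  have hPc : (P - C c).natDegree ≤ n := by rwa [natDegree_sub_C]
  have hsub := compare (P - C c) hPc fun w hw he => by
    rw [eval_sub, eval_C, sub_eq_zero] at he
    have := hm w hw.le
    rw [he, hcn] at this
    exact this.false
  have hR' : (conjReflect n (P - C c)).eval ((R : ℂ) * z)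
      - γ * (conjReflect n (P - C c)).eval z = A - u * B := by
    rw [hA, hB, eval_conjReflect hPc hRz, eval_conjReflect hPc (hne hz),
      eval_conjReflect hP hRz, eval_conjReflect hP (hne hz)]
    simp only [eval_sub, eval_C, map_sub]
    rw [show starRingEnd ℂ c = u * m by simp [hc]]
    ring
  rw [hR', huAB, abs_of_nonpos (by linarith), hBn] at hsub
  have hL : (P - C c).eval ((R : ℂ) * z) - γ * (P - C c).eval z
      = (P.eval ((R : ℂ) * z) - γ * P.eval z) - c * (1 - γ) := by
    simp only [eval_sub, eval_C]; ring
  have htri := norm_sub_norm_le (P.eval ((R : ℂ) * z) - γ * P.eval z) (c * (1 - γ))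
  rw [← hL, norm_mul, hcn] at htri
  linarith

theorem norm_eval_mul_sub_le {n : ℕ} {P : ℂ[X]} (hP : P.natDegree ≤ n)
    (hP0 : ∀ w : ℂ, ‖w‖ < 1 → P.eval w ≠ 0) {R : ℝ} (hR : 1 ≤ R) {γ : ℂ}
    (hγ : ‖γ‖ ≤ ((R + 1) / 2) ^ n) {z : ℂ} (hz : 1 ≤ ‖z‖) :
    ‖P.eval ((R : ℂ) * z) - γ * P.eval z‖
      ≤ (1 / 2) * (‖(R : ℂ) ^ n - γ‖ * ‖z‖ ^ n + ‖1 - γ‖) * maxCircle P := by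
  have hM : 0 < maxCircle P :=
    (norm_pos_iff.2 (hP0 0 (by simp))).trans_le (norm_eval_le_maxCircle P (by simp))
  have hρ : 0 < ((R + 1) / 2) ^ n := by positivity
  have hlt : ∀ s : ℝ, 1 < s →
      ‖P.eval ((R : ℂ) * (s * z)) - ((s : ℂ)⁻¹ * γ) * P.eval (s * z)‖
        ≤ (1 / 2) * (‖(R : ℂ) ^ n - (s : ℂ)⁻¹ * γ‖ * ‖s * z‖ ^ n + ‖1 - (s : ℂ)⁻¹ * γ‖)
          * (s * maxCircle P) := by
    intro s hs
    have hs0 : 0 < s := by linarith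
    refine norm_eval_mul_sub_le_of_lt hP hP0
      (fun w hw => (norm_eval_le_maxCircle P hw).trans_lt (lt_mul_of_one_lt_left hM hs)) hR ?_ ?_
    · rw [norm_mul, norm_inv, Complex.norm_real, Real.norm_of_nonneg hs0.le,
        inv_mul_lt_iff₀ hs0]
      exact hγ.trans_lt (lt_mul_of_one_lt_left hρ hs)
    · rw [norm_mul, Complex.norm_real, Real.norm_of_nonneg hs0.le]
      nlinarith
  have hinv : ContinuousAt (fun s : ℝ => (s : ℂ)⁻¹) 1 :=
    Complex.continuous_ofReal.continuousAt.inv₀ (by simp)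
  have hev : ∀ c : ℂ, ContinuousAt (fun s : ℝ => P.eval (c * (s * z))) 1 := fun c =>
    (P.continuous.comp (by fun_prop : Continuous fun s : ℝ => c * (s * z))).continuousAt
  have hev1 : ContinuousAt (fun s : ℝ => P.eval ((s : ℂ) * z)) 1 := by simpa using hev 1
  have hl : ContinuousAt (fun s : ℝ =>
      ‖P.eval ((R : ℂ) * (s * z)) - ((s : ℂ)⁻¹ * γ) * P.eval (s * z)‖) 1 :=
    ((hev R).sub ((hinv.mul continuousAt_const).mul hev1)).norm
  have hr : ContinuousAt (fun s : ℝ =>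
      (1 / 2) * (‖(R : ℂ) ^ n - (s : ℂ)⁻¹ * γ‖ * ‖s * z‖ ^ n + ‖1 - (s : ℂ)⁻¹ * γ‖)
        * (s * maxCircle P)) 1 := by
    have h1 : ContinuousAt (fun s : ℝ => ‖(s : ℂ) * z‖ ^ n) 1 :=
      (by fun_prop : Continuous fun s : ℝ => ‖(s : ℂ) * z‖ ^ n).continuousAt
    have h2 := hinv.mul (continuousAt_const (y := γ))
    exact (continuousAt_const.mul ((((continuousAt_const.sub h2).norm).mul h1).add
      (continuousAt_const.sub h2).norm)).mul (continuousAt_id.mul continuousAt_const)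
  have := le_of_tendsto_of_tendsto (hl.tendsto.mono_left nhdsWithin_le_nhds)
    (hr.tendsto.mono_left nhdsWithin_le_nhds)
    (Filter.eventually_of_mem (self_mem_nhdsWithin (s := Set.Ioi (1 : ℝ))) hlt)
  simpa using this

theorem statement14 (n : ℕ) (P : Polynomial ℂ) (hP : P.natDegree = n)
    (hP0 : ∀ w : ℂ, ‖w‖ < 1 → P.eval w ≠ 0)
    (α β : ℂ) (hα : ‖α‖ ≤ 1) (hβ : ‖β‖ ≤ 1)
    (R : ℝ) (hR : 1 ≤ R) (z : ℂ) (hz : 1 ≤ ‖z‖) :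
    ‖P.eval ((R : ℂ) * z) - α * P.eval z
        + β * (((((R + 1) / 2) ^ n - ‖α‖ : ℝ)) : ℂ) * P.eval z‖
      ≤ (1 / 2) * (‖(R : ℂ) ^ n - α + β * (((((R + 1) / 2) ^ n - ‖α‖ : ℝ)) : ℂ)‖ * ‖z‖ ^ n
          + ‖1 - α + β * (((((R + 1) / 2) ^ n - ‖α‖ : ℝ)) : ℂ)‖)
        * maxCircle P := by
  set K : ℝ := ((R + 1) / 2) ^ n - ‖α‖ with hK
  have hK0 : 0 ≤ K := sub_nonneg.2 (hα.trans (one_le_pow₀ (by linarith)))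
  have hγ : ‖α - β * (K : ℂ)‖ ≤ ((R + 1) / 2) ^ n := by
    refine (norm_sub_le _ _).trans ?_
    rw [norm_mul, Complex.norm_real, Real.norm_of_nonneg hK0]
    nlinarith
  have := norm_eval_mul_sub_le hP.le hP0 hR hγ hz
  convert this using 2
  · ring_nf
  · ring_nf
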